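/- arXiv:1308.5853 — 2 statements merged into one kernel-verified Lean document; each statement's English description precedes it below -/
import Mathlib

section
/- Let a countable group G act on a set X, let Φ = (ℓ, φ, 𝒵, Γ, ℋ) be a chart for G, let 0 < ε < 1, let A ⊆ ℤ^ℓ × Γ be a centered rectangle, and let E be a (Φ, A, ε)-rectangular equivalence relation on X. Let U be an E-class meeting X^ℋ, let y ∈ X^ℋ, and suppose that φ(M·A)·y meets U, where M is a positive integer with M ≤ 2^{22ℓ} − 8. Then there exist 𝐯 ∈ dom(φ), a rectangle B ⊆ ℤ^ℓ × Γ, and δ > 0 such that U is (Φ, δ)-roughly B at φ(𝐯)·y ∈ X^ℋ, with A ⊑ B, 2δ·B ⊑ ε·A, and 2^{22ℓ}·B ⊆ dom(φ); moreover U is (Φ, 2δ)-roughly B + 𝐯 at y. -/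
open Pointwise

/-- Points of `ℤ^ℓ × Γ`. -/
abbrev Vec (ℓ : ℕ) (Γ : Type*) := (Fin ℓ → ℤ) × Γ

/-- A rectangle in `ℤ^ℓ × Γ`, recorded by its integer center and its radius vector.
The `Γ`-coordinate of points is unrestricted. -/
structure Rect (ℓ : ℕ) where
  center : Fin ℓ → ℤ
  radius : Fin ℓ → ℕ

namespace Rect

variable {ℓ : ℕ}

/-- The set of points of `ℤ^ℓ × Γ` belonging to the rectangle. -/
def carrier (A : Rect ℓ) (Γ : Type*) : Set (Vec ℓ Γ) :=
  {b | ∀ i, |b.1 i - A.center i| ≤ (A.radius i : ℤ)}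

/-- A rectangle is centered if its center is the origin. -/
def IsCentered (A : Rect ℓ) : Prop := A.center = 0

/-- `A ⊑ B` : a translate of `A` is contained in `B`, i.e. `L_i(A) ≤ L_i(B)` for all `i`. -/
def le (A B : Rect ℓ) : Prop := ∀ i, A.radius i ≤ B.radius i

/-- `λ · A` : the rectangle with the same center and `L_i(λ·A) = ⌊λ L_i(A)⌋`. -/
noncomputable def smul (lam : ℝ) (A : Rect ℓ) : Rect ℓ :=
  ⟨A.center, fun i => (⌊lam * (A.radius i : ℝ)⌋).toNat⟩

/-- `A + 𝐯`, the translate of `A` by `𝐯` (only the `ℤ^ℓ` part of `𝐯` matters). -/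
def translate {Γ : Type*} (A : Rect ℓ) (v : Vec ℓ Γ) : Rect ℓ :=
  ⟨fun i => A.center i + v.1 i, A.radius⟩

/-- `Aⁱ` : `A` flattened in the `i`-th direction. -/
def face (A : Rect ℓ) (i : Fin ℓ) : Rect ℓ :=
  ⟨A.center, Function.update A.radius i 0⟩

/-- `Aⁱ + sign·L_i(A)·𝐞_i`, the face of `A` perpendicular to `𝐞_i` in direction `sign`. -/
def faceRect (A : Rect ℓ) (i : Fin ℓ) (sign : ℤ) : Rect ℓ :=
  ⟨Function.update A.center i (A.center i + sign * (A.radius i : ℤ)),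
   Function.update A.radius i 0⟩

end Rect

/-- The conjugate subgroup `g H g⁻¹`. -/
def conjSubgroup {G : Type*} [Group G] (g : G) (H : Subgroup G) : Subgroup G :=
  Subgroup.map (MulAut.conj g).toMonoidHom H

/-- A chart `Φ = (ℓ, φ, 𝒵, Γ, ℋ)` for a group `G`. -/
structure Chart (G : Type*) [Group G] (ℓ : ℕ) (Γ : Type*) [AddCommGroup Γ] where
  /-- the finite collection `ℋ` of pairwise conjugate subgroups of `G` -/
  H : Finset (Subgroup G)
  /-- the centered rectangle `𝒵` -/
  Z : Rect ℓ
  /-- the domain of `φ`, a centered rectangle -/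
  D : Rect ℓ
  /-- the map `φ` (only its values on `D.carrier Γ` are relevant) -/
  φ : Vec ℓ Γ → G
  Γ_finite : Finite Γ
  H_conj : ∀ H₁ ∈ H, ∀ H₂ ∈ H, ∃ g : G, conjSubgroup g H₁ = H₂
  Z_centered : Z.IsCentered
  Z_pos : ∀ i, 0 < Z.radius i
  D_centered : D.IsCentered
  D_large : (Rect.smul 3 Z).le D
  φ_injOn : Set.InjOn φ (D.carrier Γ)
  φ_zero : φ 0 = 1
  coset_inj : ∀ r ∈ D.carrier Γ, ∀ s ∈ D.carrier Γ, ∀ H₀ ∈ H,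
    (φ s)⁻¹ * φ r ∈ H₀ → r = s
  mul_mem : ∀ r ∈ D.carrier Γ, ∀ s ∈ D.carrier Γ, ∀ H₀ ∈ H,
    ((fun z => r + s + z) '' Z.carrier Γ ⊆ D.carrier Γ) →
    ∃ z ∈ Z.carrier Γ, (φ (r + s + z))⁻¹ * (φ r * φ s) ∈ H₀
  mul_inv_mem : ∀ r ∈ D.carrier Γ, ∀ s ∈ D.carrier Γ, ∀ H₀ ∈ H,
    ((fun z => r - s + z) '' Z.carrier Γ ⊆ D.carrier Γ) →
    ∃ z ∈ Z.carrier Γ, (φ (r - s + z))⁻¹ * (φ r * (φ s)⁻¹) ∈ H₀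
  inv_mul_mem : ∀ r ∈ D.carrier Γ, ∀ s ∈ D.carrier Γ, ∀ H₀ ∈ H,
    ((fun z => -r + s + z) '' Z.carrier Γ ⊆ D.carrier Γ) →
    ∃ z ∈ Z.carrier Γ, (φ (-r + s + z))⁻¹ * ((φ r)⁻¹ * φ s) ∈ H₀
  inv_mem : ∀ s ∈ D.carrier Γ, ∀ H₀ ∈ H,
    ((fun z => -s + z) '' Z.carrier Γ ⊆ D.carrier Γ) →
    ∃ z ∈ Z.carrier Γ, (φ (-s + z))⁻¹ * (φ s)⁻¹ ∈ H₀

section ChartAction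

variable {G : Type*} [Group G] {ℓ : ℕ} {Γ : Type*} [AddCommGroup Γ]

/-- `X^ℋ = {x ∈ X : Stab(x) ∈ ℋ}`. -/
def XH (Φ : Chart G ℓ Γ) (X : Type*) [MulAction G X] : Set X :=
  {x | MulAction.stabilizer G x ∈ Φ.H}

variable {X : Type*} [MulAction G X]

/-- `φ(S)·x`. -/
def chartImg (Φ : Chart G ℓ Γ) (S : Set (Vec ℓ Γ)) (x : X) : Set X :=
  (fun v => Φ.φ v • x) '' S

/-- `φ(S)·T` for a set `T ⊆ X`. -/
def chartImgSet (Φ : Chart G ℓ Γ) (S : Set (Vec ℓ Γ)) (T : Set X) : Set X :=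
  ⋃ y ∈ T, chartImg Φ S y

/-- `R` is `(Φ, ε)`-roughly `A` at `x`. -/
def RoughlyAt (Φ : Chart G ℓ Γ) (A : Rect ℓ) (ε : ℝ) (R : Set X) (x : X) : Prop :=
  0 < ε ∧ ε < 1 ∧ x ∈ XH Φ X ∧
  (Rect.smul 2 A).carrier Γ ⊆ Φ.D.carrier Γ ∧
  (Rect.smul 2 Φ.Z).le (Rect.smul ε A) ∧
  chartImg Φ ((Rect.smul (1 - ε) A).carrier Γ) x ⊆ R ∧
  R ⊆ chartImg Φ ((Rect.smul (1 + ε) A).carrier Γ) x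

/-- `R` is `(Φ, ε)`-roughly `A` (at some base point of `X^ℋ`). -/
def Roughly (Φ : Chart G ℓ Γ) (A : Rect ℓ) (ε : ℝ) (R : Set X) : Prop :=
  ∃ x : X, RoughlyAt Φ A ε R x

/-- The class `[x]_E`. -/
def eqClass {X : Type*} (E : X → X → Prop) (x : X) : Set X := {y | E x y}

/-- `E` is `(Φ, A, ε)`-rectangular. -/
def IsRectangular (Φ : Chart G ℓ Γ) (A : Rect ℓ) (ε : ℝ) (E : X → X → Prop) : Prop :=
  A.IsCentered ∧ 0 < ε ∧ ε < 1 ∧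
  (∀ x : X, ¬ (∃ y ∈ eqClass E x, y ∈ XH Φ X) → eqClass E x = {x}) ∧
  (∀ x : X, (∃ y ∈ eqClass E x, y ∈ XH Φ X) →
    ∃ (δ : ℝ) (B : Rect ℓ), 0 < δ ∧ Roughly Φ B δ (eqClass E x) ∧
      A.le B ∧ (Rect.smul ((2 : ℝ) ^ (22 * ℓ)) B).carrier Γ ⊆ Φ.D.carrier Γ ∧
      (Rect.smul (2 * δ) B).le (Rect.smul ε A))

/-- `E` is `(Φ, A, ε)`-sub-rectangular. -/
def IsSubRectangular (Φ : Chart G ℓ Γ) (A : Rect ℓ) (ε : ℝ) (E : X → X → Prop) : Prop :=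
  ∃ F : X → X → Prop, Equivalence F ∧ (∀ x y, F x y → E x y) ∧ IsRectangular Φ A ε F

/-- The `E`-saturation of a set. -/
def eSat {X : Type*} (E : X → X → Prop) (S : Set X) : Set X := {y | ∃ s ∈ S, E s y}

/-- The `(Φ, i, A)`-boundary `∂_i^Φ(E, A)`. -/
def bdry (Φ : Chart G ℓ Γ) (E : X → X → Prop) (A : Rect ℓ) (i : Fin ℓ) : Set X :=
  {x | x ∈ XH Φ X ∧
    Disjoint (eSat E (chartImg Φ ((A.faceRect i (-1)).carrier Γ) x))
             (eSat E (chartImg Φ ((A.faceRect i 1).carrier Γ) x))}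

/-- `E` and `F` are `(Φ, A)`-orthogonal. -/
def ChartOrthogonal (Φ : Chart G ℓ Γ) (A : Rect ℓ) (E F : X → X → Prop) : Prop :=
  A.IsCentered ∧ (Rect.smul ((30 * ℓ : ℕ) : ℝ) A).carrier Γ ⊆ Φ.D.carrier Γ ∧
  ∀ i : Fin ℓ,
    Disjoint (chartImgSet Φ ((Rect.smul ((30 * ℓ : ℕ) : ℝ) A).carrier Γ) (bdry Φ E A i))
             (chartImgSet Φ ((Rect.smul ((30 * ℓ : ℕ) : ℝ) A).carrier Γ) (bdry Φ F A i))

end ChartAction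

namespace Rect

variable {ℓ : ℕ} {Γ : Type*}

lemma cast_toNat_floor_le {t : ℝ} (ht : 0 ≤ t) : ((⌊t⌋.toNat : ℕ) : ℝ) ≤ t := by
  have h : ((⌊t⌋.toNat : ℕ) : ℤ) = ⌊t⌋ := Int.toNat_of_nonneg (Int.floor_nonneg.mpr ht)
  have h' : ((⌊t⌋.toNat : ℕ) : ℝ) = (⌊t⌋ : ℝ) := by exact_mod_cast h
  rw [h']
  exact Int.floor_le t

/-- Membership in `lam · A`, with the floor removed. -/
lemma mem_carrier_smul {lam : ℝ} (hlam : 0 ≤ lam) {A : Rect ℓ} {b : Vec ℓ Γ} :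
    b ∈ (smul lam A).carrier Γ ↔
      ∀ i, |(b.1 i : ℝ) - A.center i| ≤ lam * (A.radius i : ℝ) := by
  refine forall_congr' fun i => ?_
  have hnn : 0 ≤ lam * (A.radius i : ℝ) := by positivity
  change |b.1 i - A.center i| ≤ ((⌊lam * (A.radius i : ℝ)⌋.toNat : ℕ) : ℤ) ↔ _
  rw [Int.toNat_of_nonneg (Int.floor_nonneg.mpr hnn), Int.le_floor]
  push_cast
  rfl

lemma mem_carrier_iff_real {A : Rect ℓ} {b : Vec ℓ Γ} :
    b ∈ A.carrier Γ ↔ ∀ i, |(b.1 i : ℝ) - A.center i| ≤ (A.radius i : ℝ) := by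
  refine forall_congr' fun i => ?_
  rw [← Int.cast_le (R := ℝ)]
  push_cast
  rfl

lemma IsCentered.mem_carrier {A : Rect ℓ} (hA : A.IsCentered) {b : Vec ℓ Γ} :
    b ∈ A.carrier Γ ↔ ∀ i, |(b.1 i : ℝ)| ≤ (A.radius i : ℝ) := by
  have h : A.center = 0 := hA
  simp [mem_carrier_iff_real, h]

/-- A rectangle contained in a centered one satisfies `|c i| + L_i ≤ L_i(D)`. -/
lemma abs_center_add_radius_le [AddCommGroup Γ] {A D : Rect ℓ} (hD : D.IsCentered)
    (h : A.carrier Γ ⊆ D.carrier Γ) (i : Fin ℓ) :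
    |(A.center i : ℝ)| + (A.radius i : ℝ) ≤ (D.radius i : ℝ) := by
  have hp : ((fun j => A.center j + A.radius j, 0) : Vec ℓ Γ) ∈ A.carrier Γ := by
    intro j; simp
  have hm : ((fun j => A.center j - A.radius j, 0) : Vec ℓ Γ) ∈ A.carrier Γ := by
    intro j; simp
  have h1 := abs_le.mp (hD.mem_carrier.mp (h hp) i)
  have h2 := abs_le.mp (hD.mem_carrier.mp (h hm) i)
  push_cast at h1 h2
  rcases abs_cases (A.center i : ℝ) with ⟨h3, -⟩ | ⟨h3, -⟩ <;> linarith [h1.2, h2.1]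

end Rect

section ChartAction

variable {G X : Type*} [Group G] [MulAction G X] {ℓ : ℕ} {Γ : Type*} [AddCommGroup Γ]

lemma smul_eq_smul_of_inv_mul_mem_stabilizer {g h : G} {x : X}
    (hgh : g⁻¹ * h ∈ MulAction.stabilizer G x) : h • x = g • x := by
  rw [MulAction.mem_stabilizer_iff, mul_smul, inv_smul_eq_iff] at hgh
  exact hgh

/-- In a rough rectangle the radius of `𝒵` is at most half of `ε L_i(A)`. -/
lemma two_mul_radius_Z_le {Φ : Chart G ℓ Γ} {A : Rect ℓ} {ε : ℝ} (hε : 0 < ε)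
    (h : (Rect.smul 2 Φ.Z).le (Rect.smul ε A)) (i : Fin ℓ) :
    2 * (Φ.Z.radius i : ℝ) ≤ ε * (A.radius i : ℝ) := by
  have h1 := h i
  have h2 : (Rect.smul 2 Φ.Z).radius i = 2 * Φ.Z.radius i := by
    have : (2 : ℝ) * (Φ.Z.radius i : ℝ) = ((2 * Φ.Z.radius i : ℕ) : ℝ) := by push_cast; ring
    simp only [Rect.smul, this, Int.floor_natCast, Int.toNat_natCast]
  rw [h2] at h1
  have h3 : ((2 * Φ.Z.radius i : ℕ) : ℝ) ≤ ((Rect.smul ε A).radius i : ℝ) := by exact_mod_cast h1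
  push_cast at h3
  exact h3.trans (Rect.cast_toNat_floor_le (by positivity))

/-- If `2δ · B ⊑ ε · A` with `A ⊑ B` and `ε < 1`, and `2δ · B` is not flat
in direction `i`, then `2δ < 1`. -/
lemma two_mul_lt_one_of_smul_le {A B : Rect ℓ} {δ ε : ℝ} (hε : 0 < ε) (hε1 : ε < 1)
    (hAB : A.le B) (h : (Rect.smul (2 * δ) B).le (Rect.smul ε A)) {i : Fin ℓ}
    (hi : 1 ≤ 2 * δ * (B.radius i : ℝ)) : 2 * δ < 1 := by
  by_contra! hδ
  have hfloor : B.radius i ≤ (Rect.smul (2 * δ) B).radius i := by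
    have : (B.radius i : ℤ) ≤ ⌊2 * δ * (B.radius i : ℝ)⌋ := by
      rw [Int.le_floor]
      push_cast
      nlinarith [(Nat.cast_nonneg (B.radius i) : (0 : ℝ) ≤ _)]
    change B.radius i ≤ ⌊2 * δ * (B.radius i : ℝ)⌋.toNat
    omega
  have h1 : (B.radius i : ℝ) ≤ ε * (A.radius i : ℝ) := by
    have : (B.radius i : ℝ) ≤ ((Rect.smul ε A).radius i : ℝ) := by
      exact_mod_cast hfloor.trans (h i)
    exact this.trans (Rect.cast_toNat_floor_le (by positivity))
  have h2 : (A.radius i : ℝ) ≤ (B.radius i : ℝ) := by exact_mod_cast hAB i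
  have h3 : (0 : ℝ) < B.radius i := by
    rcases (Nat.cast_nonneg (B.radius i) : (0 : ℝ) ≤ _).eq_or_lt with h0 | h0
    · rw [← h0] at hi; norm_num at hi
    · exact h0
  nlinarith

/-- Rebasing a rough rectangle from `φ(v)·y` to `y`. -/
lemma RoughlyAt.translate {Φ : Chart G ℓ Γ} {B : Rect ℓ} {δ : ℝ} {U : Set X} {y : X}
    {v : Vec ℓ Γ} (hv : v ∈ Φ.D.carrier Γ) (hy : y ∈ XH Φ X) (hδ : 2 * δ < 1)
    (hB : RoughlyAt Φ B δ U (Φ.φ v • y))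
    (hD : (Rect.smul 2 (B.translate v)).carrier Γ ⊆ Φ.D.carrier Γ) :
    RoughlyAt Φ (B.translate v) (2 * δ) U y := by
  obtain ⟨hδ0, hδ1, hx, hBD, hZ, hin, hout⟩ := hB
  have hZ' := two_mul_radius_Z_le hδ0 hZ
  have hr (i) : (0 : ℝ) ≤ B.radius i := Nat.cast_nonneg _
  have hδr (i) : 0 ≤ δ * (B.radius i : ℝ) := mul_nonneg hδ0.le (hr i)
  have hδr' (i) : 2 * (δ * (B.radius i : ℝ)) ≤ B.radius i := by nlinarith [hr i]
  refine ⟨by linarith, hδ, hy, hD, fun i => (hZ i).trans ?_, ?_, ?_⟩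
  · exact Int.toNat_le_toNat (Int.floor_le_floor (by
      change δ * (B.radius i : ℝ) ≤ 2 * δ * (B.radius i : ℝ)
      linarith [hδr i]))
  · rintro _ ⟨u, hu, rfl⟩
    rw [Rect.mem_carrier_smul (by linarith)] at hu
    simp only [Rect.translate] at hu
    have huz : ∀ z ∈ Φ.Z.carrier Γ, u - v + z ∈ (Rect.smul (1 - δ) B).carrier Γ := by
      intro z hz
      rw [Rect.mem_carrier_smul (by linarith)]
      intro i
      have h1 := abs_le.mp (hu i)
      have h2 := abs_le.mp (Φ.Z_centered.mem_carrier.mp hz i)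
      have h3 := hZ' i
      have h4 := hδr i
      simp only [Prod.fst_add, Prod.fst_sub, Pi.add_apply, Pi.sub_apply]
      push_cast at h1 ⊢
      rw [abs_le]
      constructor <;> nlinarith
    have hsub : (Rect.smul (1 - δ) B).carrier Γ ⊆ Φ.D.carrier Γ := fun w hw => by
      refine hBD ?_
      rw [Rect.mem_carrier_smul (by linarith)] at hw ⊢
      exact fun i => (hw i).trans (by nlinarith [hr i])
    have huD : u ∈ Φ.D.carrier Γ := hD <| by
      rw [Rect.mem_carrier_smul (by norm_num)]
      exact fun i => (hu i).trans (by
        change _ ≤ 2 * (B.radius i : ℝ)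
        nlinarith [hr i])
    obtain ⟨z, hz, hzH⟩ := Φ.mul_inv_mem u huD v hv _ hx
      (by rintro _ ⟨z, hz, rfl⟩; exact hsub (huz z hz))
    have heq := smul_eq_smul_of_inv_mul_mem_stabilizer hzH
    rw [mul_smul, inv_smul_smul] at heq
    change Φ.φ u • y ∈ U
    rw [heq]
    exact hin ⟨_, huz z hz, rfl⟩
  · intro p hp
    obtain ⟨b, hb, rfl⟩ := hout hp
    rw [Rect.mem_carrier_smul (by linarith)] at hb
    have hbD : b ∈ Φ.D.carrier Γ := hBD <| by
      rw [Rect.mem_carrier_smul (by norm_num)]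
      exact fun i => (hb i).trans (by nlinarith [hr i])
    have hbz : ∀ z ∈ Φ.Z.carrier Γ,
        b + v + z ∈ (Rect.smul (1 + 2 * δ) (B.translate v)).carrier Γ := by
      intro z hz
      rw [Rect.mem_carrier_smul (by linarith)]
      intro i
      have h1 := abs_le.mp (hb i)
      have h2 := abs_le.mp (Φ.Z_centered.mem_carrier.mp hz i)
      have h3 := hZ' i
      have h4 := hδr i
      simp only [Prod.fst_add, Pi.add_apply, Rect.translate]
      push_cast
      rw [abs_le]
      constructor <;> nlinarith
    have hsub : (Rect.smul (1 + 2 * δ) (B.translate v)).carrier Γ ⊆ Φ.D.carrier Γ :=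
      fun w hw => by
        refine hD ?_
        rw [Rect.mem_carrier_smul (by linarith)] at hw ⊢
        exact fun i => (hw i).trans (by
          change _ * (B.radius i : ℝ) ≤ _ * (B.radius i : ℝ)
          nlinarith [hr i])
    obtain ⟨z, hz, hzH⟩ := Φ.mul_mem b hbD v hv _ hy
      (by rintro _ ⟨z, hz, rfl⟩; exact hsub (hbz z hz))
    refine ⟨b + v + z, hbz z hz, ?_⟩
    have heq := smul_eq_smul_of_inv_mul_mem_stabilizer hzH
    rw [mul_smul] at heq
    exact heq.symm

end ChartAction

/-- **Lemma 4.4 (finding a base point near a given point).**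
Let `G` act on `X`, let `Φ = (ℓ, φ, 𝒵, Γ, ℋ)` be a chart for `G`, let `0 < ε < 1`, let `A` be
a centered rectangle, and let `E` be a `(Φ, A, ε)`-rectangular equivalence relation on `X`.
Let `U` be an `E`-class meeting `X^ℋ`, let `y ∈ X^ℋ`, and suppose `φ(M·A)·y` meets `U`,
where `M ≤ 2^{22ℓ} − 8`. Then there are `𝐯 ∈ dom(φ)`, a rectangle `B` and `δ > 0` such that
`U` is `(Φ, δ)`-roughly `B` at `φ(𝐯)·y ∈ X^ℋ`, `A ⊑ B`, `2δ·B ⊑ ε·A`, and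
`2^{22ℓ}·B ⊆ dom(φ)`; moreover `U` is `(Φ, 2δ)`-roughly `B + 𝐯` at `y`. -/
theorem rough_base {G X : Type*} [Group G] [Countable G] [MulAction G X]
    {ℓ : ℕ} {Γ : Type*} [AddCommGroup Γ] (Φ : Chart G ℓ Γ)
    (ε : ℝ) (A : Rect ℓ)
    (E : X → X → Prop) (hE : Equivalence E)
    (hrect : IsRectangular Φ A ε E)
    (U : Set X) (x₀ : X) (hU : U = eqClass E x₀)
    (hUXH : (U ∩ XH Φ X).Nonempty)
    (y : X) (hy : y ∈ XH Φ X)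
    (M : ℕ) (hM0 : 0 < M) (hM : M ≤ 2 ^ (22 * ℓ) - 8)
    (hmeet : (chartImg Φ ((Rect.smul (M : ℝ) A).carrier Γ) y ∩ U).Nonempty) :
    ∃ v ∈ Φ.D.carrier Γ, ∃ (B : Rect ℓ) (δ : ℝ), 0 < δ ∧
      RoughlyAt Φ B δ U (Φ.φ v • y) ∧
      A.le B ∧
      (Rect.smul (2 * δ) B).le (Rect.smul ε A) ∧
      (Rect.smul ((2 : ℝ) ^ (22 * ℓ)) B).carrier Γ ⊆ Φ.D.carrier Γ ∧
      RoughlyAt Φ (B.translate v) (2 * δ) U y := by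
  obtain ⟨hA, hε, hε1, -, hcls⟩ := hrect
  subst hU
  obtain ⟨q, hqU, hqH⟩ := hUXH
  obtain ⟨δ, B, hδ, ⟨x, hx⟩, hAB, hND, hδB⟩ := hcls x₀ ⟨q, hqU, hqH⟩
  obtain ⟨-, hδ1, hxH, hBD, hZ, -, hout⟩ := id hx
  obtain ⟨_, ⟨m, hm, rfl⟩, hmU⟩ := hmeet
  obtain ⟨b, hb, hbm⟩ := hout hmU
  have hZ' := two_mul_radius_Z_le hδ hZ
  have hMN : M + 8 ≤ 2 ^ (22 * ℓ) := by omega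
  have hMN' : (M : ℝ) + 8 ≤ 2 ^ (22 * ℓ) := by exact_mod_cast hMN
  have hℓ : 0 < ℓ := by
    rcases Nat.eq_zero_or_pos ℓ with rfl | h
    · norm_num at hMN; omega
    · exact h
  have hr (i) : (0 : ℝ) ≤ B.radius i := Nat.cast_nonneg _
  have hδr (i) : δ * (B.radius i : ℝ) ≤ B.radius i := by nlinarith [hr i]
  have hAB' (i) : (M : ℝ) * A.radius i ≤ M * B.radius i :=
    mul_le_mul_of_nonneg_left (by exact_mod_cast hAB i) (Nat.cast_nonneg M)
  -- `|c i| + (M + 8) L_i(B) ≤ L_i(D)`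
  have hlarge (i) : |(B.center i : ℝ)| + (M * B.radius i + 8 * B.radius i) ≤ Φ.D.radius i := by
    have h1 := Rect.abs_center_add_radius_le Φ.D_centered hND i
    have h2 : (Rect.smul ((2 : ℝ) ^ (22 * ℓ)) B).radius i = 2 ^ (22 * ℓ) * B.radius i := by
      have : (2 : ℝ) ^ (22 * ℓ) * (B.radius i : ℝ) = ((2 ^ (22 * ℓ) * B.radius i : ℕ) : ℝ) := by
        push_cast; ring
      simp only [Rect.smul, this, Int.floor_natCast, Int.toNat_natCast]
    rw [h2] at h1
    push_cast at h1
    change |(B.center i : ℝ)| + _ ≤ _ at h1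
    linarith [mul_le_mul_of_nonneg_right hMN' (hr i)]
  have hMr (i) : 0 ≤ (M : ℝ) * B.radius i := mul_nonneg (Nat.cast_nonneg M) (hr i)
  have hm' (i) : |(m.1 i : ℝ)| ≤ M * B.radius i := by
    change A.center = 0 at hA
    have h := (Rect.mem_carrier_smul (Nat.cast_nonneg M)).mp hm i
    simp only [hA, Pi.zero_apply, Int.cast_zero, sub_zero] at h
    exact h.trans (hAB' i)
  have hmD : m ∈ Φ.D.carrier Γ := Φ.D_centered.mem_carrier.mpr fun i => by
    linarith [hm' i, hlarge i, hr i, abs_nonneg (B.center i : ℝ)]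
  have hb' (i) : |(b.1 i : ℝ) - B.center i| ≤ 2 * B.radius i := by
    have h := (Rect.mem_carrier_smul (by linarith)).mp hb i
    linarith [hδr i]
  have hbD : b ∈ Φ.D.carrier Γ := hBD ((Rect.mem_carrier_smul (by norm_num)).mpr hb')
  have hvc : ∀ z ∈ Φ.Z.carrier Γ, ∀ i,
      |((-b + m + z).1 i : ℝ) + B.center i| ≤ M * B.radius i + 3 * B.radius i := by
    intro z hz i
    have h1 := abs_le.mp (hb' i)
    have h2 := abs_le.mp (hm' i)
    have h3 := abs_le.mp (Φ.Z_centered.mem_carrier.mp hz i)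
    have h4 := hZ' i
    have h5 := hδr i
    simp only [Prod.fst_add, Prod.fst_neg, Pi.add_apply, Pi.neg_apply]
    push_cast
    rw [abs_le]
    constructor <;> linarith [hr i]
  have hvD : ∀ z ∈ Φ.Z.carrier Γ, -b + m + z ∈ Φ.D.carrier Γ := by
    intro z hz
    refine Φ.D_centered.mem_carrier.mpr fun i => ?_
    have h1 := abs_le.mp (hvc z hz i)
    have h2 := hlarge i
    have h3 := abs_le.mp (le_refl |(B.center i : ℝ)|)
    rw [abs_le]
    constructor <;> linarith [hr i]
  obtain ⟨z, hz, hzH⟩ := Φ.inv_mul_mem b hbD m hmD _ hy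
    (by rintro _ ⟨z, hz, rfl⟩; exact hvD z hz)
  have hvy : Φ.φ (-b + m + z) • y = x := by
    rw [← smul_eq_smul_of_inv_mul_mem_stabilizer hzH, mul_smul, inv_smul_eq_iff]
    exact hbm.symm
  have h2δ : 2 * δ < 1 := by
    refine two_mul_lt_one_of_smul_le hε hε1 hAB hδB (i := ⟨0, hℓ⟩) ?_
    have h1 : (1 : ℝ) ≤ Φ.Z.radius ⟨0, hℓ⟩ := by exact_mod_cast Φ.Z_pos ⟨0, hℓ⟩
    linarith [hZ' ⟨0, hℓ⟩]
  rw [← hvy] at hx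
  refine ⟨_, hvD z hz, B, δ, hδ, hx, hAB, hδB, hND, hx.translate (hvD z hz) hy h2δ ?_⟩
  intro w hw
  rw [Rect.mem_carrier_smul (by norm_num)] at hw
  refine Φ.D_centered.mem_carrier.mpr fun i => ?_
  have h1 := abs_le.mp (hw i)
  have h2 := abs_le.mp (hvc z hz i)
  have h3 := hlarge i
  have h4 := abs_nonneg (B.center i : ℝ)
  simp only [Rect.translate, Int.cast_add] at h1
  rw [abs_le]
  constructor <;> linarith [hr i]
end

section
/- Let a countable group G act on a set X, let Φ = (ℓ, φ, 𝒵, Γ, ℋ) be a chart for G, let ε > 0, let q satisfy 6ε < q < 1 − ε, and let A ⊆ ℤ^ℓ × Γ be a centered rectangle. Let E be a (Φ, A, ε)-rectangular equivalence relation on X and suppose the E-class U is (Φ, δ)-roughly B at x ∈ X^ℋ, where A ⊑ B, 2^{22ℓ}·B ⊆ dom(φ), and 2δ·B ⊑ ε·A. If 𝐛 = L(B), then for each 1 ≤ i ≤ ℓ, ∂_i^Φ(E, q·A) ∩ U ⊆ φ(−b_i·𝐞_i + Bⁱ + 2q·A)·x ∪ φ(b_i·𝐞_i + Bⁱ + 2q·A)·x.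 -/
open Pointwise

theorem Rect.smul_radius_of_nonneg {ℓ : ℕ} {lam : ℝ} (h : 0 ≤ lam) (A : Rect ℓ) (j : Fin ℓ) :
    ((Rect.smul lam A).radius j : ℤ) = ⌊lam * (A.radius j : ℝ)⌋ :=
  Int.toNat_of_nonneg (Int.floor_nonneg.2 (by positivity))

/-- If a rectangle lies in a centered rectangle `D`, then its radii and the moduli of its center
coordinates fit together in the radii of `D`. -/
theorem Rect.abs_center_add_radius_le_s12 {ℓ : ℕ} {Γ : Type*} [Zero Γ] {A D : Rect ℓ}
    (hD : D.IsCentered) (h : A.carrier Γ ⊆ D.carrier Γ) (j : Fin ℓ) :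
    |A.center j| + A.radius j ≤ (D.radius j : ℤ) := by
  have hc : D.center j = 0 := congrFun hD j
  have hp := h (show ((fun k => A.center k + A.radius k, 0) : Vec ℓ Γ) ∈ A.carrier Γ by
    intro k; simp) j
  have hm := h (show ((fun k => A.center k - A.radius k, 0) : Vec ℓ Γ) ∈ A.carrier Γ by
    intro k; simp) j
  simp only [hc, sub_zero] at hp hm
  grind

/-- A point whose coordinates lie within `B` enlarged by `A`, and whose `i`-th coordinate is close
to that of the face of `B` in direction `s`, lies in the sum of that face and `A`. -/
theorem Rect.mem_faceRect_add {ℓ : ℕ} {Γ : Type*} [AddCommGroup Γ] {A B : Rect ℓ}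
    (hA : A.IsCentered) {i : Fin ℓ} {s : ℤ} {u : Vec ℓ Γ}
    (hi : |u.1 i - (B.center i + s * B.radius i)| ≤ A.radius i)
    (hj : ∀ j, |u.1 j - B.center j| ≤ B.radius j + A.radius j) :
    u ∈ (B.faceRect i s).carrier Γ + A.carrier Γ := by
  have key : ∀ j, ∃ f : ℤ, |f - (B.faceRect i s).center j| ≤ ((B.faceRect i s).radius j : ℤ) ∧
      |u.1 j - f - A.center j| ≤ A.radius j := by
    intro j
    have hc : A.center j = 0 := congrFun hA j
    rw [hc]
    by_cases h : j = i
    · subst h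
      exact ⟨B.center j + s * B.radius j, by simp [Rect.faceRect], by simpa using hi⟩
    · simp only [Rect.faceRect, Function.update_of_ne h]
      have := hj j
      refine ⟨B.center j + max (-(B.radius j : ℤ)) (min (B.radius j : ℤ) (u.1 j - B.center j)), ?_, ?_⟩ <;>
        grind
  choose f hf hf' using key
  exact ⟨(f, 0), hf, (u.1 - f, u.2), hf', by ext <;> simp⟩

/-- The chart law for products, read off on the orbit of a point of `X^ℋ`. -/
theorem Chart.exists_smul_smul_eq {G X : Type*} [Group G] [MulAction G X] {ℓ : ℕ} {Γ : Type*}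
    [AddCommGroup Γ] (Φ : Chart G ℓ Γ) {x : X} (hx : x ∈ XH Φ X) {r s : Vec ℓ Γ}
    (hr : r ∈ Φ.D.carrier Γ) (hs : s ∈ Φ.D.carrier Γ)
    (h : ∀ z ∈ Φ.Z.carrier Γ, r + s + z ∈ Φ.D.carrier Γ) :
    ∃ z ∈ Φ.Z.carrier Γ, Φ.φ r • Φ.φ s • x = Φ.φ (r + s + z) • x := by
  obtain ⟨z, hz, hst⟩ := Φ.mul_mem r hr s hs _ hx (by rintro _ ⟨z, hz, rfl⟩; exact h z hz)
  refine ⟨z, hz, ?_⟩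
  rw [MulAction.mem_stabilizer_iff, mul_smul, inv_smul_eq_iff, mul_smul] at hst
  exact hst

/-- The numerical estimates in one coordinate: `a`, `b`, `z` are radii of `A`, `B`, `𝒵`. -/
theorem floor_estimates {a b z : ℕ} {ε q δ : ℝ} (hε : 0 < ε) (hq1 : 6 * ε < q) (hq2 : q < 1 - ε)
    (hab : a ≤ b) (hz : 0 < z) (hzb : ⌊(2 : ℝ) * z⌋ ≤ ⌊δ * b⌋)
    (hδ : ⌊2 * δ * b⌋ ≤ ⌊ε * a⌋) :
    ⌊(1 + δ) * b⌋ ≤ b + ⌊ε * a⌋ ∧ b - ⌊ε * a⌋ ≤ ⌊(1 - δ) * b⌋ ∧ (z : ℤ) ≤ ⌊ε * a⌋ ∧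
      3 * ⌊ε * a⌋ ≤ ⌊q * a⌋ ∧ 2 * ⌊q * a⌋ ≤ ⌊2 * q * a⌋ ∧ ⌊q * a⌋ + ⌊ε * a⌋ ≤ b := by
  have hz1 : (1 : ℝ) ≤ z := by exact_mod_cast hz
  have hab' : (a : ℝ) ≤ b := by exact_mod_cast hab
  have ha : (0 : ℝ) ≤ a := Nat.cast_nonneg a
  have h2z : 2 * (z : ℝ) ≤ δ * b := by
    have h : (2 * z : ℤ) ≤ ⌊δ * b⌋ := by
      refine le_trans (Int.le_floor.2 ?_) hzb
      push_cast
      exact le_rfl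
    have := Int.le_floor.1 h
    push_cast at this
    exact this
  have hδe : δ * b ≤ (⌊ε * a⌋ : ℝ) := by
    have h1 := Int.lt_floor_add_one (2 * δ * b)
    have h2 : (⌊2 * δ * b⌋ : ℝ) ≤ ⌊ε * a⌋ := by exact_mod_cast hδ
    linarith
  have hf := Int.floor_le (ε * a)
  have hfq := Int.floor_le (q * a)
  have hqa : 6 * (ε * a) ≤ q * a := by nlinarith
  have hqa' : q * a + ε * a ≤ a := by nlinarith
  refine ⟨?_, ?_, ?_, ?_, ?_, ?_⟩
  · have h1 := Int.floor_le ((1 + δ) * b)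
    have : (⌊(1 + δ) * b⌋ : ℝ) ≤ b + ⌊ε * a⌋ := by linarith
    exact_mod_cast this
  · rw [Int.le_floor]; push_cast; linarith
  · have : (z : ℝ) ≤ ⌊ε * a⌋ := by linarith
    exact_mod_cast this
  · rw [Int.le_floor]; push_cast; linarith
  · rw [Int.le_floor]; push_cast; linarith
  · have : (⌊q * a⌋ + ⌊ε * a⌋ : ℝ) ≤ b := by linarith
    exact_mod_cast this

/-- **Lemma 5.3 (boundaries lie near the faces).**
Let `G` act on `X`, let `Φ` be a chart for `G`, let `ε > 0`, let `q` satisfy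
`6ε < q < 1 − ε`, and let `A` be a centered rectangle. Let `E` be a `(Φ, A, ε)`-rectangular
equivalence relation and suppose the `E`-class `U` is `(Φ, δ)`-roughly `B` at `x ∈ X^ℋ`,
where `A ⊑ B`, `2^{22ℓ}·B ⊆ dom(φ)`, and `2δ·B ⊑ ε·A`. Then for each `1 ≤ i ≤ ℓ`,
`∂_i^Φ(E, q·A) ∩ U ⊆ φ(−b_i·𝐞_i + Bⁱ + 2q·A)·x ∪ φ(b_i·𝐞_i + Bⁱ + 2q·A)·x`. -/
theorem bdry_near_faces {G X : Type*} [Group G] [Countable G] [MulAction G X]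
    {ℓ : ℕ} {Γ : Type*} [AddCommGroup Γ] (Φ : Chart G ℓ Γ)
    (ε q : ℝ) (hε : 0 < ε) (hq1 : 6 * ε < q) (hq2 : q < 1 - ε)
    (A : Rect ℓ)
    (E : X → X → Prop) (hE : Equivalence E)
    (hrect : IsRectangular Φ A ε E)
    (U : Set X) (x₀ : X) (hU : U = eqClass E x₀)
    (x : X) (δ : ℝ) (B : Rect ℓ)
    (hrough : RoughlyAt Φ B δ U x)
    (hAB : A.le B)
    (hBdom : (Rect.smul ((2 : ℝ) ^ (22 * ℓ)) B).carrier Γ ⊆ Φ.D.carrier Γ)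
    (hδ : (Rect.smul (2 * δ) B).le (Rect.smul ε A))
    (i : Fin ℓ) :
    bdry Φ E (Rect.smul q A) i ∩ U ⊆
      chartImg Φ ((B.faceRect i (-1)).carrier Γ + (Rect.smul (2 * q) A).carrier Γ) x ∪
      chartImg Φ ((B.faceRect i 1).carrier Γ + (Rect.smul (2 * q) A).carrier Γ) x := by
  rintro y ⟨⟨-, hdisj⟩, hyU⟩
  obtain ⟨hA, -, -, -, -⟩ := hrect
  obtain ⟨hδ0, hδ1, hx, h2B, hZB, hin, hout⟩ := hrough
  obtain ⟨u, hu, rfl⟩ := hout hyU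
  have hq0 : 0 ≤ q := by linarith
  have est := fun j => floor_estimates hε hq1 hq2 (hAB j) (Φ.Z_pos j)
    (by
      rw [← Rect.smul_radius_of_nonneg (by norm_num), ← Rect.smul_radius_of_nonneg hδ0.le]
      exact_mod_cast hZB j)
    (by
      rw [← Rect.smul_radius_of_nonneg (by linarith), ← Rect.smul_radius_of_nonneg hε.le]
      exact_mod_cast hδ j)
  have hu' : ∀ j, |u.1 j - B.center j| ≤ ⌊(1 + δ) * (B.radius j : ℝ)⌋ := fun j => by
    rw [← Rect.smul_radius_of_nonneg (by linarith)]
    exact hu j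
  have hD : ∀ j, |B.center j| + 2 * B.radius j ≤ (Φ.D.radius j : ℤ) := fun j => by
    have h := Rect.abs_center_add_radius_le_s12 (Γ := Γ) Φ.D_centered h2B j
    rw [Rect.smul_radius_of_nonneg (by norm_num)] at h
    have h2 : (2 * B.radius j : ℤ) ≤ ⌊(2 : ℝ) * B.radius j⌋ := by
      rw [Int.le_floor]; push_cast; exact le_rfl
    simp only [Rect.smul] at h
    linarith
  have hDc : ∀ j, Φ.D.center j = 0 := congrFun Φ.D_centered
  have hZc : ∀ j, Φ.Z.center j = 0 := congrFun Φ.Z_centered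
  have hAc : ∀ j, A.center j = 0 := congrFun hA
  by_cases hnear : (B.radius i : ℤ) - ⌊2 * q * (A.radius i : ℝ)⌋ ≤ |u.1 i - B.center i|
  · have hface : ∀ s : ℤ, |u.1 i - (B.center i + s * B.radius i)| ≤ ⌊2 * q * (A.radius i : ℝ)⌋ →
        u ∈ (B.faceRect i s).carrier Γ + (Rect.smul (2 * q) A).carrier Γ := fun s hs => by
      refine Rect.mem_faceRect_add (A := Rect.smul (2 * q) A) hA ?_ fun j => ?_ <;>
        rw [Rect.smul_radius_of_nonneg (by linarith)]
      · exact hs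
      · obtain ⟨h1, h2, h3, h4, h5, h6⟩ := est j
        have := hu' j
        omega
    obtain ⟨h1, h2, h3, h4, h5, h6⟩ := est i
    have hui := hu' i
    rcases le_total 0 (u.1 i - B.center i) with h | h
    · refine Or.inr ⟨u, hface 1 ?_, rfl⟩
      rw [abs_of_nonneg h] at hui hnear
      rw [abs_le]
      constructor <;> linarith
    · refine Or.inl ⟨u, hface (-1) ?_, rfl⟩
      rw [abs_of_nonpos h] at hui hnear
      rw [abs_le]
      constructor <;> linarith
  · exfalso
    push Not at hnear
    have hmeet : ∀ s : ℤ, |s| = 1 →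
        ∃ p ∈ ((Rect.smul q A).faceRect i s).carrier Γ, Φ.φ p • Φ.φ u • x ∈ U := by
      intro s hs
      have key : ∀ j, ∃ p : ℤ, |p - ((Rect.smul q A).faceRect i s).center j| ≤
          (((Rect.smul q A).faceRect i s).radius j : ℤ) ∧ |p| ≤ B.radius j ∧
          |p + u.1 j - B.center j| + Φ.Z.radius j ≤ ⌊(1 - δ) * (B.radius j : ℝ)⌋ := by
        intro j
        obtain ⟨h1, h2, h3, h4, h5, h6⟩ := est j
        have huj := hu' j
        by_cases h : j = i
        · subst h
          refine ⟨s * ⌊q * (A.radius j : ℝ)⌋, ?_, ?_, ?_⟩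
          · simp only [Rect.faceRect, Function.update_self,
              Rect.smul_radius_of_nonneg hq0]
            simp [Rect.smul, hAc]
          · rw [abs_mul, hs, one_mul, abs_of_nonneg (by omega)]
            omega
          · have hp : |s * ⌊q * (A.radius j : ℝ)⌋| = ⌊q * (A.radius j : ℝ)⌋ := by
              rw [abs_mul, hs, one_mul, abs_of_nonneg (by omega)]
            have := abs_add_le (s * ⌊q * (A.radius j : ℝ)⌋) (u.1 j - B.center j)
            rw [add_sub_assoc]
            omega
        · simp only [Rect.faceRect, Function.update_of_ne h, Rect.smul_radius_of_nonneg hq0]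
          have hc : (Rect.smul q A).center j = 0 := hAc j
          rw [hc]
          refine ⟨max (-⌊q * (A.radius j : ℝ)⌋)
            (min ⌊q * (A.radius j : ℝ)⌋ (B.center j - u.1 j)), ?_, ?_, ?_⟩ <;>
          grind
      choose p hpf hpB hpU using key
      have hnear' : ∀ z ∈ Φ.Z.carrier Γ,
          ((p, 0) + u + z : Vec ℓ Γ) ∈ (Rect.smul (1 - δ) B).carrier Γ := by
        intro z hz j
        rw [Rect.smul_radius_of_nonneg (by linarith)]
        have h1 := hz j
        have h2 := hpU j
        rw [hZc, sub_zero] at h1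
        have h3 := abs_add_le (p j + u.1 j - B.center j) (z.1 j)
        have h4 : ((p, 0) + u + z : Vec ℓ Γ).1 j - (Rect.smul (1 - δ) B).center j =
            p j + u.1 j - B.center j + z.1 j := by
          simp only [Prod.fst_add, Pi.add_apply, Rect.smul]
          ring
        rw [h4]
        omega
      have hsub : ∀ lam : ℝ, 0 ≤ lam → lam ≤ 2 →
          (Rect.smul lam B).carrier Γ ⊆ Φ.D.carrier Γ := by
        intro lam h0 h2 v hv
        refine h2B fun j => (hv j).trans ?_
        rw [Rect.smul_radius_of_nonneg h0, Rect.smul_radius_of_nonneg (by norm_num)]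
        gcongr
      obtain ⟨z, hz, hpz⟩ := Φ.exists_smul_smul_eq hx (r := (p, 0)) (s := u)
        (fun j => by
          have h1 := hD j
          have h2 := hpB j
          rw [hDc, sub_zero]
          have h3 := abs_nonneg (B.center j)
          change |p j| ≤ _
          omega)
        (hsub _ (by linarith) (by linarith) hu)
        (fun z hz => hsub _ (by linarith) (by linarith) (hnear' z hz))
      refine ⟨(p, 0), hpf, ?_⟩
      rw [hpz]
      exact hin ⟨_, hnear' z hz, rfl⟩
    obtain ⟨p, hp, hpU⟩ := hmeet (-1) (by norm_num)
    obtain ⟨r, hr, hrU⟩ := hmeet 1 (by norm_num)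
    rw [hU] at hpU hrU
    exact Set.disjoint_left.1 hdisj ⟨_, ⟨p, hp, rfl⟩, hE.symm hpU⟩ ⟨_, ⟨r, hr, rfl⟩, hE.symm hrU⟩
end
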